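/- Let G be a simple graph on n ≥ 2 vertices with Laplacian matrix L. Then τ_1(L) ≤ τ_∞(L). -/

import Mathlib

open Matrix Polynomial Filter
open scoped ENNReal

/-- The `l_p` norm of a vector in `ℝⁿ`, for `p ∈ [0,∞]`. -/
noncomputable def lpNorm (p : ℝ≥0∞) {n : ℕ} (x : Fin n → ℝ) : ℝ :=
  ‖(WithLp.equiv p (Fin n → ℝ)).symm x‖

/-- The vector-norm based ergodicity coefficient `τ_p(A)`. -/
noncomputable def tau (p : ℝ≥0∞) {n : ℕ} (A : Matrix (Fin n) (Fin n) ℝ) : ℝ :=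
  sSup {y : ℝ | ∃ x : Fin n → ℝ, (∑ i, x i) = 0 ∧ lpNorm p x = 1 ∧ y = lpNorm p (Aᵀ *ᵥ x)}

/-- The all-ones matrix `J`. -/
def allOnes (n : ℕ) : Matrix (Fin n) (Fin n) ℝ := Matrix.of fun _ _ => 1

theorem lpNorm_one_eq_sum {n : ℕ} (x : Fin n → ℝ) : lpNorm 1 x = ∑ i, |x i| := by
  simp [lpNorm, PiLp.norm_eq_of_L1]

theorem lpNorm_top_eq_norm {n : ℕ} (x : Fin n → ℝ) : lpNorm ⊤ x = ‖x‖ :=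
  PiLp.norm_toLp x

/-- The `l₁` operator norm of a matrix is bounded by its largest absolute column sum. -/
theorem sum_abs_mulVec_le {n : ℕ} (A : Matrix (Fin n) (Fin n) ℝ) {K : ℝ}
    (hA : ∀ j, ∑ i, |A i j| ≤ K) (x : Fin n → ℝ) :
    ∑ i, |(A *ᵥ x) i| ≤ K * ∑ i, |x i| := by
  calc ∑ i, |(A *ᵥ x) i| ≤ ∑ i, ∑ j, |A i j| * |x j| := by
        refine Finset.sum_le_sum fun i _ => ?_
        simp only [Matrix.mulVec, dotProduct, ← abs_mul]
        exact Finset.abs_sum_le_sum_abs _ _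
    _ = ∑ j, (∑ i, |A i j|) * |x j| := by
        rw [Finset.sum_comm]
        simp only [Finset.sum_mul]
    _ ≤ ∑ j, K * |x j| := by
        gcongr with j
        exact hA j
    _ = K * ∑ i, |x i| := by rw [Finset.mul_sum]

/-- Adding a multiple of the all-ones matrix does not change the action on zero-sum vectors. -/
theorem mulVec_add_const_of_sum_eq_zero {n : ℕ} (A : Matrix (Fin n) (Fin n) ℝ) (c : ℝ)
    {x : Fin n → ℝ} (hx : ∑ i, x i = 0) :
    (A + Matrix.of fun _ _ => c) *ᵥ x = A *ᵥ x := by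
  ext i
  simp [Matrix.mulVec, dotProduct, add_mul, Finset.sum_add_distrib, ← Finset.mul_sum, hx]

theorem tau_one_le_of_col_sum_le {n : ℕ} (A : Matrix (Fin n) (Fin n) ℝ) (c : ℝ) {K : ℝ}
    (hK : 0 ≤ K) (hA : ∀ j, ∑ i, |Aᵀ i j + c| ≤ K) : tau 1 A ≤ K := by
  refine Real.sSup_le ?_ hK
  rintro y ⟨x, hx, hx1, rfl⟩
  rw [lpNorm_one_eq_sum] at hx1 ⊢
  have h := sum_abs_mulVec_le (Aᵀ + Matrix.of fun _ _ => c) (K := K) (by simpa using hA) x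
  rwa [mulVec_add_const_of_sum_eq_zero _ _ hx, hx1, mul_one] at h

theorem tau_nonneg (p : ℝ≥0∞) [Fact (1 ≤ p)] {n : ℕ} (A : Matrix (Fin n) (Fin n) ℝ) :
    0 ≤ tau p A := by
  refine Real.sSup_nonneg ?_
  rintro y ⟨x, -, -, rfl⟩
  exact norm_nonneg _

theorem le_tau_top {n : ℕ} (A : Matrix (Fin n) (Fin n) ℝ) {x : Fin n → ℝ}
    (hx : ∑ i, x i = 0) (hx1 : ‖x‖ = 1) (i : Fin n) : (Aᵀ *ᵥ x) i ≤ tau ⊤ A := by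
  have hbdd : BddAbove {y : ℝ | ∃ x : Fin n → ℝ, (∑ i, x i) = 0 ∧ lpNorm ⊤ x = 1 ∧
      y = lpNorm ⊤ (Aᵀ *ᵥ x)} := by
    refine ⟨‖LinearMap.toContinuousLinearMap (Matrix.toLin' Aᵀ)‖, ?_⟩
    rintro y ⟨x, -, hx1, rfl⟩
    rw [lpNorm_top_eq_norm] at hx1 ⊢
    simpa [hx1] using (LinearMap.toContinuousLinearMap (Matrix.toLin' Aᵀ)).le_opNorm x
  calc (Aᵀ *ᵥ x) i ≤ ‖(Aᵀ *ᵥ x) i‖ := Real.le_norm_self _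
    _ ≤ ‖Aᵀ *ᵥ x‖ := norm_le_pi_norm _ i
    _ = lpNorm ⊤ (Aᵀ *ᵥ x) := (lpNorm_top_eq_norm _).symm
    _ ≤ tau ⊤ A := le_csSup hbdd ⟨x, hx, by rw [lpNorm_top_eq_norm, hx1], rfl⟩

section Laplacian

variable {n : ℕ} (G : SimpleGraph (Fin n)) [DecidableRel G.Adj]

theorem lapMatrix_apply_eq (i j : Fin n) :
    G.lapMatrix ℝ i j = (if i = j then (G.degree j : ℝ) else 0) - if G.Adj j i then 1 else 0 := by
  by_cases h : i = j <;>
    simp [SimpleGraph.lapMatrix, SimpleGraph.degMatrix, h, G.adj_comm]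

theorem sum_ite_adj (j : Fin n) : ∑ i, (if G.Adj j i then (1 : ℝ) else 0) = G.degree j := by
  simp [Finset.sum_boole, ← SimpleGraph.card_neighborFinset_eq_degree,
    SimpleGraph.neighborFinset_eq_filter]

theorem sum_abs_lapMatrix_col (j : Fin n) :
    ∑ i, |G.lapMatrix ℝ i j| = 2 * G.degree j := by
  have h (i : Fin n) : |G.lapMatrix ℝ i j| =
      (if i = j then (G.degree j : ℝ) else 0) + if G.Adj j i then 1 else 0 := by
    rw [lapMatrix_apply_eq]
    rcases eq_or_ne i j with rfl | hij
    · simp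
    · simp only [hij, if_false]
      split_ifs <;> simp
  simp only [h, Finset.sum_add_distrib, sum_ite_adj]
  simp [two_mul]

theorem sum_abs_lapMatrix_col_add_one (j : Fin n) :
    ∑ i, |G.lapMatrix ℝ i j + 1| = n := by
  have h (i : Fin n) : |G.lapMatrix ℝ i j + 1| =
      (if i = j then (G.degree j : ℝ) else 0) - (if G.Adj j i then 1 else 0) + 1 := by
    rw [lapMatrix_apply_eq]
    refine abs_of_nonneg ?_
    rcases eq_or_ne i j with rfl | hij
    · simp
      positivity
    · simp only [hij, if_false]
      split_ifs <;> simp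
  simp only [h, Finset.sum_add_distrib, Finset.sum_sub_distrib, sum_ite_adj]
  simp

theorem tau_one_lapMatrix_le {Δ : ℕ} (hΔ : ∀ j, G.degree j ≤ Δ) :
    tau 1 (G.lapMatrix ℝ) ≤ min (2 * (Δ : ℝ)) n := by
  have hsymm : (G.lapMatrix ℝ)ᵀ = G.lapMatrix ℝ := (G.isSymm_lapMatrix (R := ℝ)).eq
  refine le_min (tau_one_le_of_col_sum_le _ 0 (by positivity) fun j => ?_)
    (tau_one_le_of_col_sum_le _ 1 (by positivity) fun j => ?_)
  · simp only [hsymm, add_zero, sum_abs_lapMatrix_col]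
    have : (G.degree j : ℝ) ≤ Δ := by exact_mod_cast hΔ j
    linarith
  · simp only [hsymm, sum_abs_lapMatrix_col_add_one, le_refl]

/-- A vertex of degree `d` bounds `τ_∞` from below through the zero-sum vectors taking the value
`1` at the vertex, `a` on its neighbours and `b` elsewhere. -/
theorem degree_mul_le_tau_top_lapMatrix (v : Fin n) {a b : ℝ} (ha : |a| ≤ 1) (hb : |b| ≤ 1)
    (hab : 1 + G.degree v * a + (n - 1 - G.degree v) * b = 0) :
    G.degree v * (1 - a) ≤ tau ⊤ (G.lapMatrix ℝ) := by
  let x : Fin n → ℝ := fun i => if i = v then 1 else if G.Adj v i then a else b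
  have hx (i : Fin n) : x i = (if i = v then 1 - b else 0) +
      (if G.Adj v i then (1 : ℝ) else 0) * (a - b) + b := by
    rcases eq_or_ne i v with rfl | hiv
    · simp [x]
    · simp only [x, hiv, if_false]
      split_ifs <;> ring
  have hsum : ∑ i, x i = 0 := by
    simp only [hx, Finset.sum_add_distrib, ← Finset.sum_mul, sum_ite_adj]
    simp
    linarith
  have hnorm : ‖x‖ = 1 := by
    refine le_antisymm ((pi_norm_le_iff_of_nonneg zero_le_one).2 fun i => ?_) ?_
    · simp only [x, Real.norm_eq_abs]
      split_ifs <;> simp [ha, hb]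
    · simpa [x] using norm_le_pi_norm x v
  have hval : ((G.lapMatrix ℝ)ᵀ *ᵥ x) v = G.degree v * (1 - a) := by
    have h (i : Fin n) : G.lapMatrix ℝ i v * x i =
        (if i = v then (G.degree v : ℝ) else 0) - (if G.Adj v i then 1 else 0) * a := by
      rw [lapMatrix_apply_eq]
      rcases eq_or_ne i v with rfl | hiv
      · simp [x]
      · simp only [x, hiv, if_false]
        split_ifs <;> ring
    simp only [Matrix.mulVec, dotProduct, Matrix.transpose_apply, h, Finset.sum_sub_distrib,
      ← Finset.sum_mul, sum_ite_adj]
    simp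
    ring
  exact hval ▸ le_tau_top _ hsum hnorm v

theorem min_le_tau_top_lapMatrix (v : Fin n) :
    min (2 * (G.degree v : ℝ)) n ≤ tau ⊤ (G.lapMatrix ℝ) := by
  have hlt : G.degree v + 1 ≤ n := by simpa using G.degree_lt_card_verts v
  rcases Nat.eq_zero_or_pos (G.degree v) with h0 | hpos
  · exact (min_le_left _ _).trans (by simpa [h0] using tau_nonneg ⊤ (G.lapMatrix ℝ))
  have hlt' : (G.degree v : ℝ) + 1 ≤ n := by exact_mod_cast hlt
  have hpos' : (1 : ℝ) ≤ G.degree v := by exact_mod_cast hpos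
  rcases le_total (2 * (G.degree v : ℝ)) n with h | h
  · refine (min_le_left _ _).trans ?_
    have hb : |((G.degree v : ℝ) - 1) / (n - 1 - G.degree v)| ≤ 1 := by
      rw [abs_of_nonneg (div_nonneg (by linarith) (by linarith))]
      exact div_le_one_of_le₀ (by linarith) (by linarith)
    have key := degree_mul_le_tau_top_lapMatrix G v (a := -1) (by simp) hb (by
      rw [mul_div_cancel_of_imp' fun h' => by linarith]
      ring)
    linarith
  · refine (min_le_right _ _).trans ?_
    have hd : (G.degree v : ℝ) ≠ 0 := by positivity
    have ha : |-((n - G.degree v : ℝ) / G.degree v)| ≤ 1 := by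
      rw [abs_neg, abs_of_nonneg (div_nonneg (by linarith) (by linarith))]
      exact div_le_one_of_le₀ (by linarith) (by linarith)
    have key := degree_mul_le_tau_top_lapMatrix G v ha (b := 1) (by simp) (by
      field_simp
      ring)
    refine le_of_eq_of_le ?_ key
    field_simp
    ring

end Laplacian

/-- `τ₁(L) ≤ τ_∞(L)` for the Laplacian matrix of every simple graph (Theorem 4.4). -/
theorem tau_one_le_tau_infty_lapMatrix {n : ℕ} (hn : 2 ≤ n) (G : SimpleGraph (Fin n))
    [DecidableRel G.Adj] :
    tau 1 (G.lapMatrix ℝ) ≤ tau ⊤ (G.lapMatrix ℝ) := by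
  have : Nonempty (Fin n) := ⟨⟨0, by omega⟩⟩
  obtain ⟨v, hv⟩ := Finite.exists_max fun v => G.degree v
  exact (tau_one_lapMatrix_le G hv).trans (min_le_tau_top_lapMatrix G v)
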